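/- arXiv:2403.01959 — 2 statements merged into one kernel-verified Lean document; each statement's English description precedes it below -/
import Mathlib

section
/- Let N ≥ 1 and c ≥ 0, with c > 0 if N = 1. Set 2*_c = 2(N+1+c)/(N+c−1). Then there exists a constant C = C(c,N) > 0 such that for every u ∈ C_c^∞(cl(ℝ^{N+1}_+)) one has ‖u‖_{L^{2*_c}_c} ≤ C ‖∇u‖_{L²_c}. -/
open MeasureTheory Real

noncomputable section

/-- The upper half-space `ℝ^{N+1}_+`. -/
def HS (N : ℕ) : Set ((Fin N → ℝ) × ℝ) := {z | 0 < z.2}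

/-- Partial derivative of `u` in the `i`-th `x` direction. -/
def pX {N : ℕ} (u : ((Fin N → ℝ) × ℝ) → ℝ) (i : Fin N) (z : (Fin N → ℝ) × ℝ) : ℝ :=
  fderiv ℝ u z (Pi.single i 1, 0)

/-- Partial derivative of `u` in the `y` direction. -/
def pY {N : ℕ} (u : ((Fin N → ℝ) × ℝ) → ℝ) (z : (Fin N → ℝ) × ℝ) : ℝ :=
  fderiv ℝ u z (0, 1)

/-- Euclidean norm of the full gradient `∇u`. -/
def gradNorm {N : ℕ} (u : ((Fin N → ℝ) × ℝ) → ℝ) (z : (Fin N → ℝ) × ℝ) : ℝ :=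
  Real.sqrt ((∑ i, pX u i z ^ 2) + pY u z ^ 2)

section Aux

open scoped ENNReal
open Set Filter Topology

theorem gridA_aux {N : ℕ} {p : ℝ} (hp₀ : 0 ≤ p) (hp : ((N : ℝ) - 1) * p ≤ 1)
    {v g : (Fin N → ℝ) → ℝ≥0∞} (hv : Measurable v) (hg : Measurable g)
    (h : ∀ x i, v x ≤ ∫⁻ t, g (Function.update x i t)) {a b : ℝ≥0∞}
    (ha0 : a ≠ 0) (ha : a ≠ ⊤) (hb0 : b ≠ 0) (hb : b ≠ ⊤)
    (hva : ∫⁻ x, v x ≤ a) (hgb : ∫⁻ x, g x ≤ b) :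
    ∫⁻ x, v x ^ (1 + p) ≤ 2 ^ (1 + p) * (a ^ (1 - ((N : ℝ) - 1) * p) * b ^ (N * p)) := by
  set s := 1 - ((N : ℝ) - 1) * p with hs
  have hs0 : 0 ≤ s := by linarith
  set f : (Fin N → ℝ) → ℝ≥0∞ := fun x => v x / a + g x / b with hf
  have hfm : Measurable f := by fun_prop
  have hint : ∫⁻ x, f x ≤ 2 := by
    rw [hf, lintegral_add_left (by fun_prop)]
    simp_rw [div_eq_mul_inv]
    rw [lintegral_mul_const _ hv, lintegral_mul_const _ hg, ← one_add_one_eq_two]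
    gcongr
    · rw [← div_eq_mul_inv]; exact ENNReal.div_le_of_le_mul (by simpa using hva)
    · rw [← div_eq_mul_inv]; exact ENNReal.div_le_of_le_mul (by simpa using hgb)
  have h1 : ∀ x, v x ≤ a * f x := by
    intro x
    calc v x = a * (v x / a) := (ENNReal.mul_div_cancel ha0 ha).symm
      _ ≤ _ := by gcongr; exact le_self_add
  have h2 : ∀ x i, v x ≤ b * ∫⁻ t, f (Function.update x i t) := by
    intro x i
    calc v x ≤ ∫⁻ t, g (Function.update x i t) := h x i
      _ = b * ((∫⁻ t, g (Function.update x i t)) / b) := (ENNReal.mul_div_cancel hb0 hb).symm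
      _ = b * ∫⁻ t, g (Function.update x i t) / b := by
        simp_rw [div_eq_mul_inv]
        rw [lintegral_mul_const' _ _ (ENNReal.inv_ne_top.2 hb0)]
      _ ≤ _ := by gcongr; exact le_add_self
  have key := lintegral_mul_prod_lintegral_pow_le (fun _ : Fin N => (volume : Measure ℝ)) hp₀
    (by simpa using hp) hfm
  simp only [Fintype.card_fin] at key
  rw [← hs] at key
  calc ∫⁻ x, v x ^ (1 + p)
      ≤ ∫⁻ x, (a ^ s * b ^ (N * p)) * (f x ^ s *
          ∏ i, (∫⁻ t, f (Function.update x i t)) ^ p) := by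
        gcongr with x
        have e : v x ^ (1 + p) = v x ^ s * ∏ i : Fin N, v x ^ p := by
          rw [Finset.prod_const, Finset.card_univ, Fintype.card_fin, ← ENNReal.rpow_natCast,
            ← ENNReal.rpow_mul, ← ENNReal.rpow_add_of_nonneg _ _ hs0 (by positivity)]
          congr 1; rw [hs]; ring
        rw [e]
        calc v x ^ s * ∏ i : Fin N, v x ^ p
            ≤ (a * f x) ^ s * ∏ i : Fin N, (b * ∫⁻ t, f (Function.update x i t)) ^ p := by
              gcongr with i
              · exact h1 x
              · exact h2 x i
          _ = _ := by
              simp_rw [ENNReal.mul_rpow_of_nonneg _ _ hs0, ENNReal.mul_rpow_of_nonneg _ _ hp₀]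
              rw [Finset.prod_mul_distrib, Finset.prod_const, Finset.card_univ, Fintype.card_fin,
                ← ENNReal.rpow_natCast, ← ENNReal.rpow_mul, mul_comm p]
              ring
    _ ≤ (a ^ s * b ^ (N * p)) * (∫⁻ x, f x) ^ (1 + p) := by
        rw [lintegral_const_mul' _ _ (ENNReal.mul_ne_top
          (ENNReal.rpow_ne_top_of_nonneg hs0 ha) (ENNReal.rpow_ne_top_of_nonneg (by positivity) hb))]
        gcongr
        exact key
    _ ≤ (a ^ s * b ^ (N * p)) * 2 ^ (1 + p) := by gcongr
    _ = _ := mul_comm _ _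

theorem gridA {N : ℕ} (hN : 1 ≤ N) {p : ℝ} (hp₀ : 0 < p) (hp : ((N : ℝ) - 1) * p ≤ 1)
    {v g : (Fin N → ℝ) → ℝ≥0∞} (hv : Measurable v) (hg : Measurable g)
    (h : ∀ x i, v x ≤ ∫⁻ t, g (Function.update x i t))
    (ha : ∫⁻ x, v x ≠ ⊤) (hb : ∫⁻ x, g x ≠ ⊤) :
    ∫⁻ x, v x ^ (1 + p) ≤
      2 ^ (1 + p) * ((∫⁻ x, v x) ^ (1 - ((N : ℝ) - 1) * p) * (∫⁻ x, g x) ^ (N * p)) := by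
  by_cases ha0 : ∫⁻ x, v x = 0
  · have : ∫⁻ x, v x ^ (1 + p) = 0 := by
      rw [lintegral_eq_zero_iff hv] at ha0
      rw [lintegral_eq_zero_iff (by fun_prop)]
      filter_upwards [ha0] with x hx
      simp only [Pi.zero_apply] at hx ⊢
      rw [hx, ENNReal.zero_rpow_of_pos (by linarith)]
    rw [this]; exact zero_le
  by_cases hb0 : ∫⁻ x, g x = 0
  · have hNp : 0 < (N : ℝ) * p := by
      have : (1 : ℝ) ≤ N := by exact_mod_cast hN
      positivity
    have key : ∀ n : ℕ, ∫⁻ x, v x ^ (1 + p) ≤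
      2 ^ (1 + p) * ((∫⁻ x, v x) ^ (1 - ((N : ℝ) - 1) * p) * ((n : ℝ≥0∞)⁻¹ ^ (N * p))) := by
      intro n
      rcases Nat.eq_zero_or_pos n with rfl | hn
      · simp only [Nat.cast_zero, ENNReal.inv_zero]
        rw [ENNReal.top_rpow_of_pos hNp, ENNReal.mul_top, ENNReal.mul_top]
        · exact le_top
        · simp
        · simp [ENNReal.rpow_eq_zero_iff, ha0, ha]
      · exact gridA_aux hp₀.le hp hv hg h ha0 ha (by simp) (by simp; omega) le_rfl (by simp [hb0])
    have lim : Tendsto (fun n : ℕ => 2 ^ (1 + p) * ((∫⁻ x, v x) ^ (1 - ((N : ℝ) - 1) * p) *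
        ((n : ℝ≥0∞)⁻¹ ^ (N * p)))) atTop (𝓝 (2 ^ (1 + p) * ((∫⁻ x, v x) ^ (1 - ((N : ℝ) - 1) * p) *
        (0 ^ (N * p))))) := by
      refine ENNReal.Tendsto.const_mul (ENNReal.Tendsto.const_mul ?_ (Or.inr ?_)) (Or.inr ?_)
      · exact (ENNReal.continuous_rpow_const.tendsto 0).comp ENNReal.tendsto_inv_nat_nhds_zero
      · exact ENNReal.rpow_ne_top_of_nonneg (by linarith) ha
      · exact ENNReal.rpow_ne_top_of_nonneg (by linarith) (by simp)
    rw [hb0]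
    exact ge_of_tendsto' lim key
  · exact gridA_aux hp₀.le hp hv hg h ha0 ha hb0 hb le_rfl le_rfl

theorem int_pow {c t : ℝ} (hc : 0 < c) (ht : 0 < t) :
    ∫⁻ y in Ioo 0 t, ENNReal.ofReal y ^ (c - 1) = ENNReal.ofReal t ^ c * (ENNReal.ofReal c)⁻¹ := by
  have e : ∫⁻ y in Ioo 0 t, ENNReal.ofReal y ^ (c - 1)
      = ∫⁻ y in Ioc 0 t, ENNReal.ofReal (y ^ (c - 1)) := by
    rw [setLIntegral_congr (Ioo_ae_eq_Ioc (μ := volume) (a := 0) (b := t))]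
    refine setLIntegral_congr_fun measurableSet_Ioc fun y hy => ?_
    exact ENNReal.ofReal_rpow_of_pos hy.1
  have hi : IntervalIntegrable (fun y : ℝ => y ^ (c - 1)) volume 0 t :=
    intervalIntegral.intervalIntegrable_rpow' (by linarith)
  rw [e, ← ofReal_integral_eq_lintegral_ofReal, ← intervalIntegral.integral_of_le ht.le,
    integral_rpow (Or.inl (by linarith))]
  · rw [sub_add_cancel, Real.zero_rpow hc.ne', sub_zero, div_eq_mul_inv,
      ENNReal.ofReal_mul (by positivity), ENNReal.ofReal_rpow_of_pos ht, ENNReal.ofReal_inv_of_pos hc]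
  · exact (intervalIntegrable_iff_integrableOn_Ioc_of_le ht.le).1 hi
  · filter_upwards [ae_restrict_mem measurableSet_Ioc] with y hy
    exact Real.rpow_nonneg hy.1.le _

theorem hardy {c : ℝ} (hc : 0 < c) {A : ℝ → ℝ≥0∞} (hA : Measurable A) :
    ∫⁻ y in Ioi 0, (∫⁻ t in Ioi y, A t) * ENNReal.ofReal y ^ (c - 1) =
      (∫⁻ t in Ioi 0, A t * ENNReal.ofReal t ^ c) * (ENNReal.ofReal c)⁻¹ := by
  have hS : MeasurableSet {z : ℝ × ℝ | 0 < z.1 ∧ z.1 < z.2} := by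
    apply MeasurableSet.inter
    · exact measurableSet_lt measurable_const measurable_fst
    · exact measurableSet_lt measurable_fst measurable_snd
  set F : ℝ → ℝ → ℝ≥0∞ := fun y t =>
    indicator {z : ℝ × ℝ | 0 < z.1 ∧ z.1 < z.2} (fun z => A z.2 * ENNReal.ofReal z.1 ^ (c - 1)) (y, t)
    with hF
  have hFm : Measurable (Function.uncurry F) := by
    have : Function.uncurry F = indicator {z : ℝ × ℝ | 0 < z.1 ∧ z.1 < z.2}
      (fun z => A z.2 * ENNReal.ofReal z.1 ^ (c - 1)) := by ext ⟨y, t⟩; rfl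
    rw [this]
    exact Measurable.indicator (by fun_prop) hS
  have e1 : ∫⁻ y in Ioi 0, (∫⁻ t in Ioi y, A t) * ENNReal.ofReal y ^ (c - 1)
      = ∫⁻ y, ∫⁻ t, F y t := by
    rw [← lintegral_indicator measurableSet_Ioi]
    congr 1; ext y
    by_cases hy : 0 < y
    · rw [indicator_of_mem (by exact hy), ← lintegral_mul_const _ hA,
        ← lintegral_indicator measurableSet_Ioi]
      congr 1; ext t
      simp only [hF, indicator, mem_Ioi, mem_ofPred_eq, hy, true_and]
    · rw [indicator_of_notMem (by exact hy)]
      simp [hF, indicator, hy]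
  have e2 : (∫⁻ t in Ioi 0, A t * ENNReal.ofReal t ^ c) * (ENNReal.ofReal c)⁻¹
      = ∫⁻ t, ∫⁻ y, F y t := by
    rw [← lintegral_mul_const _ (by fun_prop), ← lintegral_indicator measurableSet_Ioi]
    congr 1; ext t
    by_cases ht : 0 < t
    · rw [indicator_of_mem (by exact ht), mul_assoc, ← int_pow hc ht,
        ← lintegral_const_mul _ (by fun_prop), ← lintegral_indicator measurableSet_Ioo]
      congr 1; 
    · rw [indicator_of_notMem (by exact ht)]
      have : ∀ y, F y t = 0 := by
        intro y
        simp only [hF]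
        apply indicator_of_notMem
        rintro ⟨h1, h2⟩
        exact ht (lt_trans h1 h2)
      simp [this]
  rw [e1, e2, lintegral_lintegral_swap hFm.aemeasurable]

theorem L1_abs {N : ℕ} (hN : 1 ≤ N) {c : ℝ} (hc : 0 ≤ c)
    {v g : (Fin N → ℝ) × ℝ → ℝ≥0∞} (hv : Measurable v) (hg : Measurable g)
    (hx : ∀ x i y, v (x, y) ≤ ∫⁻ t, g (Function.update x i t, y))
    (hy : ∀ x y, v (x, y) ≤ ∫⁻ t in Ioi y, g (x, t))
    (hvf : ∀ y, ∫⁻ x, v (x, y) ≠ ⊤) (hgf : ∀ y, ∫⁻ x, g (x, y) ≠ ⊤)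
    {p : ℝ} (hp : p = 1 / (N + c)) :
    ∫⁻ z in HS N, v z ^ (1 + p) * ENNReal.ofReal z.2 ^ c ≤
      (2 ^ (1 + p) * (ENNReal.ofReal c)⁻¹ ^ (c * p)) *
        (∫⁻ z in HS N, g z * ENNReal.ofReal z.2 ^ c) ^ (1 + p) := by
  have hN1 : (1 : ℝ) ≤ N := by exact_mod_cast hN
  have hNc : 0 < (N : ℝ) + c := by linarith
  have hp0 : 0 < p := by rw [hp]; positivity
  have hpe : p * (N + c) = 1 := by rw [hp]; field_simp
  have hHS : (volume : Measure ((Fin N → ℝ) × ℝ)).restrict (HS N)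
      = (volume : Measure (Fin N → ℝ)).prod ((volume : Measure ℝ).restrict (Ioi 0)) := by
    have : HS N = univ ×ˢ Ioi (0 : ℝ) := by ext z; simp [HS]
    rw [this, Measure.volume_eq_prod, ← Measure.prod_restrict, Measure.restrict_univ]
  have ton : ∀ F : (Fin N → ℝ) × ℝ → ℝ≥0∞, Measurable F →
      ∫⁻ z in HS N, F z * ENNReal.ofReal z.2 ^ c
        = ∫⁻ y in Ioi 0, (∫⁻ x, F (x, y)) * ENNReal.ofReal y ^ c := by
    intro F hF
    rw [hHS, lintegral_prod_symm' _ (by fun_prop)]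
    congr 1; ext y
    have hFy : Measurable (fun x => F (x, y)) := by fun_prop
    exact lintegral_mul_const (ENNReal.ofReal y ^ c) hFy
  rw [ton _ (by fun_prop), ton _ hg]
  set A : ℝ → ℝ≥0∞ := fun y => ∫⁻ x, g (x, y) with hA
  have hAm : Measurable A := hg.lintegral_prod_left'
  set h : ℝ → ℝ≥0∞ := fun y => ∫⁻ t in Ioi y, A t with hh
  have hhm : Measurable h := by
    have : Antitone h := fun y z hyz => lintegral_mono_set (Ioi_subset_Ioi hyz)
    exact this.measurable
  set G := ∫⁻ y in Ioi 0, A y * ENNReal.ofReal y ^ c with hG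
  have hV : ∀ y, ∫⁻ x, v (x, y) ≤ h y := by
    intro y
    calc ∫⁻ x, v (x, y) ≤ ∫⁻ x, ∫⁻ t in Ioi y, g (x, t) := by gcongr with x; exact hy x y
      _ = h y := by
        rw [lintegral_lintegral_swap]
        exact hg.aemeasurable
  have hGh : ∀ y, 0 < y → h y * ENNReal.ofReal y ^ c ≤ G := by
    intro y hy0
    rw [hh, hG]
    simp only
    rw [← lintegral_mul_const _ hAm]
    refine le_trans ?_ (lintegral_mono_set (Ioi_subset_Ioi hy0.le))
    refine setLIntegral_mono (by fun_prop) fun t ht => ?_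
    gcongr
    exact le_of_lt ht
  have point : ∀ y, 0 < y → (∫⁻ x, v (x, y) ^ (1 + p)) * ENNReal.ofReal y ^ c ≤
      (2 ^ (1 + p) * G ^ p) * ((h y * ENNReal.ofReal y ^ (c - 1)) ^ (c * p) *
        (A y * ENNReal.ofReal y ^ c) ^ (N * p)) := by
    intro y hy0
    have hle : ((N : ℝ) - 1) * p ≤ 1 := by nlinarith
    have k := gridA hN hp0 hle (v := fun x => v (x, y)) (g := fun x => g (x, y))
      (by fun_prop) (by fun_prop) (fun x i => hx x i y) (hvf y) (hgf y)
    have es : 1 - ((N : ℝ) - 1) * p = p + c * p := by linarith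
    rw [es] at k
    set Y := ENNReal.ofReal y with hY
    have Y0 : Y ≠ 0 := by simp [hY, hy0]
    have Yt : Y ≠ ⊤ := by simp [hY]
    have hcp : 0 ≤ c * p := by positivity
    have hNp : 0 ≤ N * p := by positivity
    calc (∫⁻ x, v (x, y) ^ (1 + p)) * Y ^ c
        ≤ (2 ^ (1 + p) * ((∫⁻ x, v (x, y)) ^ (p + c * p) * (A y) ^ (N * p))) * Y ^ c := by
          gcongr
      _ ≤ (2 ^ (1 + p) * ((h y) ^ (p + c * p) * (A y) ^ (N * p))) * Y ^ c := by
          gcongr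
          exact hV y
      _ = (2 ^ (1 + p) * (h y * Y ^ c) ^ p) * ((h y * Y ^ (c - 1)) ^ (c * p) *
            (A y * Y ^ c) ^ (N * p)) := by
          have e : Y ^ c = Y ^ (c * p) * Y ^ ((c - 1) * (c * p)) * Y ^ (c * (N * p)) := by
            rw [← ENNReal.rpow_add _ _ Y0 Yt, ← ENNReal.rpow_add _ _ Y0 Yt]
            congr 1
            linear_combination (-c) * hpe
          simp only [ENNReal.mul_rpow_of_nonneg _ _ hp0.le, ENNReal.mul_rpow_of_nonneg _ _ hcp,
            ENNReal.mul_rpow_of_nonneg _ _ hNp, ← ENNReal.rpow_mul]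
          rw [e, ENNReal.rpow_add_of_nonneg _ _ hp0.le hcp]
          ring
      _ ≤ _ := by
          gcongr
          exact hGh y hy0
  have hold := ENNReal.lintegral_mul_norm_pow_le (μ := (volume : Measure ℝ).restrict (Ioi 0))
    (f := fun y => h y * ENNReal.ofReal y ^ (c - 1)) (g := fun y => A y * ENNReal.ofReal y ^ c)
    (by fun_prop) (by fun_prop) (p := c * p) (q := N * p) (by positivity) (by positivity)
    (by linarith)
  have hard : (∫⁻ y in Ioi 0, h y * ENNReal.ofReal y ^ (c - 1)) ^ (c * p) ≤
      (ENNReal.ofReal c)⁻¹ ^ (c * p) * G ^ (c * p) := by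
    rcases hc.eq_or_lt with rfl | hc
    · simp
    · rw [hh]
      simp only
      rw [hardy hc hAm, mul_comm, ENNReal.mul_rpow_of_nonneg _ _ (by positivity)]
  calc ∫⁻ y in Ioi 0, (∫⁻ x, v (x, y) ^ (1 + p)) * ENNReal.ofReal y ^ c
      ≤ ∫⁻ y in Ioi 0, (2 ^ (1 + p) * G ^ p) * ((h y * ENNReal.ofReal y ^ (c - 1)) ^ (c * p) *
        (A y * ENNReal.ofReal y ^ c) ^ (N * p)) :=
        setLIntegral_mono (by fun_prop) fun y hy0 => point y hy0
    _ = (2 ^ (1 + p) * G ^ p) * ∫⁻ y in Ioi 0, ((h y * ENNReal.ofReal y ^ (c - 1)) ^ (c * p) *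
        (A y * ENNReal.ofReal y ^ c) ^ (N * p)) := by
        rw [lintegral_const_mul _ (by fun_prop)]
    _ ≤ (2 ^ (1 + p) * G ^ p) * (((ENNReal.ofReal c)⁻¹ ^ (c * p) * G ^ (c * p)) * G ^ (N * p)) := by
        gcongr
        exact hold.trans (by gcongr)
    _ = _ := by
        have eG : G ^ (1 + p) = G ^ p * G ^ (c * p) * G ^ (N * p) := by
          rw [← ENNReal.rpow_add_of_nonneg _ _ (by positivity) (by positivity),
            ← ENNReal.rpow_add_of_nonneg _ _ (by positivity) (by positivity)]
          congr 1; linarith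
        rw [eG]
        ring


theorem line_Iic {f : ℝ → ℝ} (hf : ContDiff ℝ 1 f) (hs : HasCompactSupport f) {γ : ℝ} (hγ : 1 < γ)
    (x : ℝ) :
    ENNReal.ofReal (|f x| ^ γ) ≤
      ∫⁻ t in Iic x, ENNReal.ofReal (γ * |f t| ^ (γ - 1) * |deriv f t|) := by
  have h1 : ContDiff ℝ 1 (fun t => ‖f t‖ ^ γ) := hf.norm_rpow hγ
  have h2 : HasCompactSupport (fun t => ‖f t‖ ^ γ) :=
    hs.comp_left (g := fun s : ℝ => ‖s‖ ^ γ) (by simp; rw [Real.zero_rpow (by linarith)])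
  have h3 := h2.enorm_le_lintegral_Ici_deriv h1 x
  have e : ‖(‖f x‖ ^ γ)‖ₑ = ENNReal.ofReal (|f x| ^ γ) := by
    rw [Real.enorm_eq_ofReal (by positivity), Real.norm_eq_abs]
  rw [e] at h3
  refine h3.trans ?_
  gcongr with t
  rw [← ofReal_norm]
  apply ENNReal.ofReal_le_ofReal
  have := norm_fderiv_norm_rpow_le (hf.differentiable one_ne_zero) (x := t) hγ
  rw [← norm_deriv_eq_norm_fderiv, ← norm_deriv_eq_norm_fderiv] at this
  simpa using this

theorem line_Ioi {f : ℝ → ℝ} (hf : ContDiff ℝ 1 f) (hs : HasCompactSupport f) {γ : ℝ} (hγ : 1 < γ)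
    (x : ℝ) :
    ENNReal.ofReal (|f x| ^ γ) ≤
      ∫⁻ t in Ioi x, ENNReal.ofReal (γ * |f t| ^ (γ - 1) * |deriv f t|) := by
  have k := line_Iic (f := fun t => f (-t)) (by fun_prop)
    (hs.comp_homeomorph (Homeomorph.neg ℝ)) hγ (-x)
  simp only [neg_neg, deriv_comp_neg, abs_neg] at k
  refine k.trans (le_of_eq ?_)
  have := (Measure.measurePreserving_neg (volume : Measure ℝ)).setLIntegral_comp_preimage_emb
    (Homeomorph.neg ℝ).measurableEmbedding
    (fun t => ENNReal.ofReal (γ * |f t| ^ (γ - 1) * |deriv f t|)) (Ici x)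
  rw [setLIntegral_congr (Ioi_ae_eq_Ici (μ := volume) (a := x)), ← this]
  congr 2
  ext t; simp

theorem cs_comp {α β : Type*} [TopologicalSpace α] [TopologicalSpace β] [R1Space β]
    {u : α → ℝ} (hs : HasCompactSupport u)
    {l : β → α} {r : α → β} (hr : Continuous r) (h : ∀ t, r (l t) = t) :
    HasCompactSupport (fun t => u (l t)) := by
  refine HasCompactSupport.intro (hs.isCompact.image hr) fun t ht => ?_
  apply image_eq_zero_of_notMem_tsupport
  intro h'
  exact ht ⟨_, h', h t⟩

theorem grad_cont {N : ℕ} {u : ((Fin N → ℝ) × ℝ) → ℝ} (hu : ContDiff ℝ 1 u) :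
    Continuous (gradNorm u) := by
  have : Continuous (fderiv ℝ u) := hu.continuous_fderiv one_ne_zero
  unfold gradNorm pX pY
  fun_prop

theorem grad_zero {N : ℕ} {u : ((Fin N → ℝ) × ℝ) → ℝ} {z} (hz : z ∉ tsupport u) :
    gradNorm u z = 0 := by
  simp [gradNorm, pX, pY, fderiv_of_notMem_tsupport (𝕜 := ℝ) hz]

theorem pX_le {N : ℕ} (u : ((Fin N → ℝ) × ℝ) → ℝ) (i : Fin N) (z) : |pX u i z| ≤ gradNorm u z := by
  apply Real.abs_le_sqrt
  have := Finset.single_le_sum (f := fun i => pX u i z ^ 2) (fun i _ => sq_nonneg _)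
    (Finset.mem_univ i)
  have h2 := sq_nonneg (pY u z)
  linarith

theorem pY_le {N : ℕ} (u : ((Fin N → ℝ) × ℝ) → ℝ) (z) : |pY u z| ≤ gradNorm u z := by
  apply Real.abs_le_sqrt
  have := Finset.sum_nonneg (s := Finset.univ) (f := fun i => pX u i z ^ 2)
    (fun i _ => sq_nonneg _)
  linarith

theorem real_final {M γ q P k l i : ℝ} (hM : 1 < M) (hγ : γ = 2 * M / (M - 1))
    (hq : q = 1 + 1 / M) (hP : P = 2 * (M + 1) / (M - 1)) (hk : 0 ≤ k) (hl : 0 ≤ l) (hi : 0 ≤ i)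
    (h : l ≤ k * (γ * (l ^ (1 / 2 : ℝ) * i ^ (1 / 2 : ℝ))) ^ q) :
    l ^ (1 / P) ≤ (k ^ (1 / q) * γ + 1) * i ^ (1 / 2 : ℝ) := by
  have hM1 : 0 < M - 1 := by linarith
  have hM0 : 0 < M := by linarith
  have hγ0 : 0 < γ := by rw [hγ]; positivity
  have hq0 : 0 < q := by rw [hq]; positivity
  have hP0 : 0 < P := by rw [hP]; positivity
  rcases hl.eq_or_lt with rfl | hl
  · rw [Real.zero_rpow (by positivity)]; positivity
  have h1 : l ^ (1 / q) ≤ k ^ (1 / q) * (γ * (l ^ (1 / 2 : ℝ) * i ^ (1 / 2 : ℝ))) := by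
    calc l ^ (1 / q) ≤ (k * (γ * (l ^ (1 / 2 : ℝ) * i ^ (1 / 2 : ℝ))) ^ q) ^ (1 / q) := by gcongr
      _ = _ := by
        rw [Real.mul_rpow hk (by positivity), ← Real.rpow_mul (by positivity),
          mul_one_div_cancel hq0.ne', Real.rpow_one]
  have e : 1 / q = 1 / P + 1 / 2 := by
    rw [hq, hP]; field_simp; ring
  have e2 : l ^ (1 / q) = l ^ (1 / P) * l ^ (1 / 2 : ℝ) := by rw [e, Real.rpow_add hl]
  rw [e2] at h1
  have h3 : l ^ (1 / P) ≤ k ^ (1 / q) * γ * i ^ (1 / 2 : ℝ) := by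
    have : 0 < l ^ (1 / 2 : ℝ) := by positivity
    refine le_of_mul_le_mul_right (h1.trans (le_of_eq ?_)) this
    ring
  have : 0 ≤ i ^ (1 / 2 : ℝ) := by positivity
  linarith


theorem cs_lintegral {α : Type*} [TopologicalSpace α] [MeasurableSpace α] [OpensMeasurableSpace α]
    {μ : Measure α} [IsFiniteMeasureOnCompacts μ] {f : α → ℝ}
    (hf : Continuous f) (hs : HasCompactSupport f) : ∫⁻ x, ENNReal.ofReal (f x) ∂μ ≠ ⊤ :=
  (hf.integrable_of_hasCompactSupport hs).lintegral_lt_top.ne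

theorem int_conv {N : ℕ} {c : ℝ} (hc : 0 ≤ c) {F : (Fin N → ℝ) × ℝ → ℝ} (hF : Continuous F)
    (hF0 : ∀ z, 0 ≤ F z) (hs : HasCompactSupport F) :
    0 ≤ ∫ z in HS N, F z * z.2 ^ c ∧
    ∫⁻ z in HS N, ENNReal.ofReal (F z) * ENNReal.ofReal z.2 ^ c =
      ENNReal.ofReal (∫ z in HS N, F z * z.2 ^ c) := by
  have hm : MeasurableSet (HS N) := measurableSet_lt measurable_const measurable_snd
  have hcont : Continuous (fun z : (Fin N → ℝ) × ℝ => F z * z.2 ^ c) :=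
    hF.mul (continuous_snd.rpow_const (fun _ => Or.inr hc))
  have hi : Integrable (fun z : (Fin N → ℝ) × ℝ => F z * z.2 ^ c) :=
    hcont.integrable_of_hasCompactSupport hs.mul_right
  have hnn : ∀ z ∈ HS N, 0 ≤ F z * z.2 ^ c := fun z hz =>
    mul_nonneg (hF0 z) (Real.rpow_nonneg (le_of_lt hz) _)
  refine ⟨setIntegral_nonneg hm hnn, ?_⟩
  rw [ofReal_integral_eq_lintegral_ofReal hi.integrableOn
    ((ae_restrict_mem hm).mono hnn)]
  refine setLIntegral_congr_fun hm fun z hz => ?_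
  rw [ENNReal.ofReal_mul (hF0 z), ENNReal.ofReal_rpow_of_pos hz]

theorem L1_u {N : ℕ} (hN : 1 ≤ N) {c : ℝ} (hc : 0 ≤ c) {γ : ℝ} (hγ : 1 < γ)
    {u : ((Fin N → ℝ) × ℝ) → ℝ} (hu : ContDiff ℝ 1 u) (hs : HasCompactSupport u)
    {p : ℝ} (hp : p = 1 / (N + c)) :
    ∫⁻ z in HS N, ENNReal.ofReal (|u z| ^ γ) ^ (1 + p) * ENNReal.ofReal z.2 ^ c ≤
      (2 ^ (1 + p) * (ENNReal.ofReal c)⁻¹ ^ (c * p)) *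
        (∫⁻ z in HS N, ENNReal.ofReal (γ * |u z| ^ (γ - 1) * gradNorm u z)
          * ENNReal.ofReal z.2 ^ c) ^ (1 + p) := by
  have hgc := grad_cont hu
  have huc := hu.continuous
  have vc : Continuous (fun z => |u z| ^ γ) :=
    huc.abs.rpow_const (fun _ => Or.inr (by linarith))
  have gc : Continuous (fun z => γ * |u z| ^ (γ - 1) * gradNorm u z) :=
    (continuous_const.mul (huc.abs.rpow_const (fun _ => Or.inr (by linarith)))).mul hgc
  have vs : HasCompactSupport (fun z => |u z| ^ γ) :=
    hs.comp_left (g := fun s : ℝ => |s| ^ γ) (by simp; rw [Real.zero_rpow (by linarith)])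
  have gs : HasCompactSupport (fun z => γ * |u z| ^ (γ - 1) * gradNorm u z) :=
    HasCompactSupport.intro hs.isCompact fun z hz => by rw [grad_zero hz, mul_zero]
  have hd := hu.differentiable one_ne_zero
  refine L1_abs hN hc (v := fun z => ENNReal.ofReal (|u z| ^ γ))
    (g := fun z => ENNReal.ofReal (γ * |u z| ^ (γ - 1) * gradNorm u z))
    vc.measurable.ennreal_ofReal gc.measurable.ennreal_ofReal ?_ ?_ ?_ ?_ hp
  · intro x i y
    have hl : ∀ t, HasDerivAt (fun t => (Function.update x i t, y))
        ((Pi.single i 1, 0) : (Fin N → ℝ) × ℝ) t := fun t =>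
      (hasDerivAt_update x i t).prodMk (hasDerivAt_const t y)
    have hlc : ContDiff ℝ 1 (fun t => (Function.update x i t, y)) :=
      (contDiff_update 1 x i).prodMk contDiff_const
    have k := line_Iic (f := fun t => u (Function.update x i t, y)) (hu.comp hlc)
      (cs_comp hs (l := fun t => (Function.update x i t, y)) (r := fun z => z.1 i) (by fun_prop)
        (by simp)) hγ (x i)
    simp only [Function.update_eq_self] at k
    refine k.trans ((setLIntegral_le_lintegral _ _).trans ?_)
    gcongr with t
    have : deriv (fun t => u (Function.update x i t, y)) t = pX u i (Function.update x i t, y) :=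
      ((hd (Function.update x i t, y)).hasFDerivAt.comp_hasDerivAt t (hl t)).deriv
    rw [this]
    exact pX_le _ _ _
  · intro x y
    have hl : ∀ t : ℝ, HasDerivAt (fun t => (x, t))
        ((0, 1) : (Fin N → ℝ) × ℝ) t := fun t =>
      (hasDerivAt_const t x).prodMk (hasDerivAt_id t)
    have hlc : ContDiff ℝ 1 (fun t : ℝ => (x, t)) := by fun_prop
    have k := line_Ioi (f := fun t => u (x, t)) (hu.comp hlc)
      (cs_comp hs (l := fun t => (x, t)) (r := fun z => z.2) (by fun_prop)
        (by simp)) hγ y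
    refine k.trans ?_
    gcongr with t
    have : deriv (fun t => u (x, t)) t = pY u (x, t) :=
      ((hd (x, t)).hasFDerivAt.comp_hasDerivAt t (hl t)).deriv
    rw [this]
    exact pY_le _ _
  · intro y
    exact cs_lintegral (f := fun x => |u (x, y)| ^ γ) (vc.comp (by fun_prop : Continuous fun x => (x, y)))
      (cs_comp vs (l := fun x => (x, y)) (r := fun z => z.1) (by fun_prop) (by simp))
  · intro y
    exact cs_lintegral (f := fun x => γ * |u (x, y)| ^ (γ - 1) * gradNorm u (x, y))
      (gc.comp (by fun_prop : Continuous fun x => (x, y)))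
      (cs_comp gs (l := fun x => (x, y)) (r := fun z => z.1) (by fun_prop) (by simp))

theorem main_aux (N : ℕ) (hN : 1 ≤ N) (c : ℝ) (hc : 0 ≤ c) (hc1 : N = 1 → 0 < c)
    (p : ℝ) (hp : p = 2 * ((N : ℝ) + 1 + c) / ((N : ℝ) + c - 1)) :
    ∃ C > 0, ∀ u : ((Fin N → ℝ) × ℝ) → ℝ, ContDiff ℝ (⊤ : ℕ∞) u → HasCompactSupport u →
      (∫ z in HS N, |u z| ^ p * z.2 ^ c) ^ (1 / p) ≤
        C * (∫ z in HS N, gradNorm u z ^ 2 * z.2 ^ c) ^ (1 / 2 : ℝ) := by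
  set M : ℝ := N + c with hM
  have hM1 : 1 < M := by
    rcases hN.eq_or_lt with h | h
    · have := hc1 h.symm
      rw [hM, ← h]; push_cast; linarith
    · have : (2 : ℝ) ≤ N := by exact_mod_cast h
      linarith
  have hM1' : 0 < M - 1 := by linarith
  have hM0 : 0 < M := by linarith
  set γ := 2 * M / (M - 1) with hγ
  have hγ1 : 1 < γ := by rw [hγ, lt_div_iff₀ hM1']; linarith
  set q := 1 + 1 / M with hq
  have hq0 : 0 < q := by positivity
  have hP : p = 2 * (M + 1) / (M - 1) := by rw [hp, hM]; ring
  have hp0 : 0 < p := by rw [hP]; positivity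
  set K : ℝ≥0∞ := 2 ^ q * (ENNReal.ofReal c)⁻¹ ^ (c * (1 / M)) with hK
  have hKt : K ≠ ⊤ := by
    rw [hK]
    refine ENNReal.mul_ne_top (ENNReal.rpow_ne_top_of_nonneg hq0.le (by simp)) ?_
    rcases hc.eq_or_lt with h | h
    · rw [← h]; simp
    · exact ENNReal.rpow_ne_top_of_nonneg (by positivity) (by simp [h])
  refine ⟨K.toReal ^ (1 / q) * γ + 1, by positivity, fun u hu' hs => ?_⟩
  have hu : ContDiff ℝ 1 u := hu'.of_le (by exact_mod_cast le_top)
  have hgc := grad_cont hu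
  have hg0 : ∀ z, 0 ≤ gradNorm u z := fun z => Real.sqrt_nonneg _
  obtain ⟨l0, l1⟩ := int_conv (N := N) hc (F := fun z => |u z| ^ p)
    (hu.continuous.abs.rpow_const (fun _ => Or.inr hp0.le)) (fun z => by positivity)
    (hs.comp_left (g := fun s : ℝ => |s| ^ p) (by simp; rw [Real.zero_rpow hp0.ne']))
  obtain ⟨i0, i1⟩ := int_conv (N := N) hc (F := fun z => gradNorm u z ^ 2)
    (hgc.pow 2) (fun z => by positivity)
    (HasCompactSupport.intro hs.isCompact fun z hz => by rw [grad_zero hz]; simp)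
  refine real_final hM1 hγ hq hP ENNReal.toReal_nonneg l0 i0 ?_
  set l := ∫ z in HS N, |u z| ^ p * z.2 ^ c with hl
  set i := ∫ z in HS N, gradNorm u z ^ 2 * z.2 ^ c with hi
  have key := L1_u hN hc hγ1 hu hs (p := 1 / M) rfl
  rw [← hq, ← hK] at key
  have e1 : ∫⁻ z in HS N, ENNReal.ofReal (|u z| ^ γ) ^ q * ENNReal.ofReal z.2 ^ c
      = ENNReal.ofReal l := by
    rw [← l1]
    congr 1; ext z
    rw [ENNReal.ofReal_rpow_of_nonneg (by positivity) hq0.le, ← Real.rpow_mul (abs_nonneg _)]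
    congr 4
    rw [hγ, hq, hP]; field_simp
  have e2 : ∫⁻ z in HS N, ENNReal.ofReal (γ * |u z| ^ (γ - 1) * gradNorm u z)
          * ENNReal.ofReal z.2 ^ c ≤
      ENNReal.ofReal (γ * (l ^ (1 / 2 : ℝ) * i ^ (1 / 2 : ℝ))) := by
    have hold := ENNReal.lintegral_mul_norm_pow_le
      (μ := (volume : Measure ((Fin N → ℝ) × ℝ)).restrict (HS N))
      (f := fun z => ENNReal.ofReal (|u z| ^ p) * ENNReal.ofReal z.2 ^ c)
      (g := fun z => ENNReal.ofReal (gradNorm u z ^ 2) * ENNReal.ofReal z.2 ^ c)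
      (by have := hu.continuous.measurable; fun_prop) (by have := hgc.measurable; fun_prop)
      (p := 1 / 2) (q := 1 / 2) (by norm_num) (by norm_num) (by norm_num)
    rw [l1, i1, ENNReal.ofReal_rpow_of_nonneg l0 (by norm_num),
      ENNReal.ofReal_rpow_of_nonneg i0 (by norm_num), ← ENNReal.ofReal_mul (by positivity)] at hold
    rw [ENNReal.ofReal_mul (by positivity)]
    refine le_trans (le_of_eq ?_) (mul_le_mul_right hold _)
    rw [← lintegral_const_mul' _ _ (by simp)]
    congr 1; ext z
    have hY : ENNReal.ofReal z.2 ^ c =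
        (ENNReal.ofReal z.2 ^ c) ^ (1 / 2 : ℝ) * (ENNReal.ofReal z.2 ^ c) ^ (1 / 2 : ℝ) := by
      rw [← ENNReal.rpow_add_of_nonneg _ _ (by norm_num) (by norm_num)]
      norm_num
    rw [ENNReal.mul_rpow_of_nonneg _ _ (by norm_num), ENNReal.mul_rpow_of_nonneg _ _ (by norm_num),
      ENNReal.ofReal_rpow_of_nonneg (p := 1 / 2) (x := |u z| ^ p) (by positivity) (by norm_num),
      ENNReal.ofReal_rpow_of_nonneg (p := 1 / 2) (x := gradNorm u z ^ 2) (by positivity)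
        (by norm_num)]
    have ea : (|u z| ^ p) ^ (1 / 2 : ℝ) = |u z| ^ (γ - 1) := by
      rw [← Real.rpow_mul (abs_nonneg _)]
      congr 1
      rw [hγ, hP]; field_simp; ring
    have eb : (gradNorm u z ^ 2) ^ (1 / 2 : ℝ) = gradNorm u z := by
      rw [← Real.sqrt_eq_rpow, Real.sqrt_sq (hg0 z)]
    rw [ea, eb, ENNReal.ofReal_mul (by positivity), ENNReal.ofReal_mul (by positivity)]
    nth_rewrite 1 [hY]
    ring
  rw [e1] at key
  have key2 := key.trans (mul_le_mul_right (ENNReal.rpow_le_rpow e2 hq0.le) K)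
  have hγ0 : 0 < γ := by linarith
  rw [ENNReal.ofReal_rpow_of_nonneg (by positivity) hq0.le, ← ENNReal.ofReal_toReal hKt,
    ← ENNReal.ofReal_mul ENNReal.toReal_nonneg, ENNReal.ofReal_le_ofReal_iff (by positivity)] at key2
  exact key2


end Aux

/-- weighted Sobolev inequality: for `c ≥ 0` (`c > 0` when `N = 1`)
and `p = 2*_c = 2(N+1+c)/(N+c−1)` one has `‖u‖_{L^p_c} ≤ C ‖∇u‖_{L²_c}` for all
smooth compactly supported `u` on the closed half-space. -/
theorem stmt_4 (N : ℕ) (hN : 1 ≤ N) (c : ℝ) (hc : 0 ≤ c) (hc1 : N = 1 → 0 < c)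
    (p : ℝ) (hp : p = 2 * ((N : ℝ) + 1 + c) / ((N : ℝ) + c - 1)) :
    ∃ C > 0, ∀ u : ((Fin N → ℝ) × ℝ) → ℝ, ContDiff ℝ (⊤ : ℕ∞) u → HasCompactSupport u →
      (∫ z in HS N, |u z| ^ p * z.2 ^ c) ^ (1 / p) ≤
        C * (∫ z in HS N, gradNorm u z ^ 2 * z.2 ^ c) ^ (1 / 2 : ℝ) := by
  exact main_aux N hN c hc hc1 p hp
end
end

section
/- Let N ≥ 1 and c ≥ 0, with c > 0 if N = 1, and set 2*_c = 2(N+1+c)/(N+c−1). Let q satisfy 2 < q ≤ 2*_c and set θ = (N+1+c)(1/2 − 1/q) ∈ (0,1]. Then there exists a constant C > 0, depending only on c and N, such that for every u ∈ C_c^∞(cl(ℝ^{N+1}_+)) one has ‖u‖_{L^q_c} ≤ C ‖∇u‖_{L²_c}^{θ} ‖u‖_{L²_c}^{1−θ}. -/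
open MeasureTheory Real

noncomputable section

open Set
open scoped ENNReal

lemma w_mul_tail (c : ℝ) (hc : 0 ≤ c) (G : ℝ → ℝ≥0∞) (hG : Measurable G) (y : ℝ) (hy : 0 < y) :
    ENNReal.ofReal (y ^ c) * ∫⁻ s in Ioi y, G s ≤
      ∫⁻ s in Ioi (0:ℝ), ENNReal.ofReal (s ^ c) * G s := by
  rw [← lintegral_const_mul _ hG]
  calc ∫⁻ s in Ioi y, ENNReal.ofReal (y ^ c) * G s
      ≤ ∫⁻ s in Ioi y, ENNReal.ofReal (s ^ c) * G s := by
        apply setLIntegral_mono (by fun_prop)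
        intro s hs
        gcongr
        exact hs.le
    _ ≤ _ := by
        apply lintegral_mono_set
        exact Ioi_subset_Ioi hy.le

lemma hardy_tail (c : ℝ) (hc : 0 < c) (G : ℝ → ℝ≥0∞) (hG : Measurable G) :
    ∫⁻ y in Ioi (0:ℝ), ENNReal.ofReal (y ^ (c - 1)) * ∫⁻ s in Ioi y, G s =
      ENNReal.ofReal (1 / c) * ∫⁻ s in Ioi (0:ℝ), ENNReal.ofReal (s ^ c) * G s := by
  have h1 : ∀ y ∈ Ioi (0:ℝ), ENNReal.ofReal (y ^ (c - 1)) * ∫⁻ s in Ioi y, G s =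
      ∫⁻ s in Ioi (0:ℝ), (Ioo 0 s).indicator (fun y => ENNReal.ofReal (y ^ (c - 1))) y * G s := by
    intro y hy
    rw [← lintegral_const_mul _ hG, ← lintegral_indicator measurableSet_Ioi,
      ← lintegral_indicator measurableSet_Ioi]
    congr 1
    ext s
    simp only [indicator, mem_Ioi, mem_Ioo] at *
    by_cases h : y < s
    · have : 0 < s := hy.trans h
      simp [h, hy, this]
    · simp [h]
  have hm : Measurable (fun p : ℝ × ℝ =>
      (Ioo 0 p.2).indicator (fun y => ENNReal.ofReal (y ^ (c - 1))) p.1 * G p.2) := by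
    have : (fun p : ℝ × ℝ => (Ioo 0 p.2).indicator (fun y => ENNReal.ofReal (y ^ (c - 1))) p.1) =
      {p : ℝ × ℝ | 0 < p.1 ∧ p.1 < p.2}.indicator (fun p => ENNReal.ofReal (p.1 ^ (c - 1))) := by
      ext p; simp [indicator]
    apply Measurable.mul _ (by fun_prop)
    rw [this]
    apply Measurable.indicator (by fun_prop)
    exact (measurableSet_lt measurable_const measurable_fst).inter
      (measurableSet_lt measurable_fst measurable_snd)
  rw [setLIntegral_congr_fun measurableSet_Ioi h1, lintegral_lintegral_swap hm.aemeasurable,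
    ← lintegral_const_mul _ (by fun_prop)]
  apply setLIntegral_congr_fun measurableSet_Ioi
  intro s hs
  simp only [mem_Ioi] at hs
  dsimp only
  rw [lintegral_mul_const _ (by apply Measurable.indicator (by fun_prop) measurableSet_Ioo),
    ← mul_assoc]
  congr 1
  rw [lintegral_indicator measurableSet_Ioo, Measure.restrict_restrict measurableSet_Ioo,
    inter_eq_left.2 (fun x hx => hx.1), ← ENNReal.ofReal_mul (by positivity),
    restrict_Ioo_eq_restrict_Ioc]
  have hi : IntervalIntegrable (fun y : ℝ => y ^ (c - 1)) volume 0 s :=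
    intervalIntegral.intervalIntegrable_rpow' (by linarith)
  rw [← ofReal_integral_eq_lintegral_ofReal]
  · rw [← intervalIntegral.integral_of_le hs.le, integral_rpow (Or.inl (by linarith))]
    simp [hc.ne']
    ring_nf
  · exact (intervalIntegrable_iff_integrableOn_Ioc_of_le hs.le).1 hi
  · filter_upwards [ae_restrict_mem measurableSet_Ioc] with y hy
    exact rpow_nonneg hy.1.le _

lemma oneD (n c : ℝ) (hn : 1 ≤ n) (hc : 0 ≤ c) : ∃ K : ℝ≥0∞, K ≠ ∞ ∧ ∀ (G M : ℝ → ℝ≥0∞),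
    Measurable G → Measurable M → (∀ y > 0, M y ≤ ∫⁻ s in Ioi y, G s) →
    ∫⁻ y in Ioi (0:ℝ), ENNReal.ofReal (y ^ c) *
      (M y ^ ((1 + c) / (n + c)) * G y ^ (n / (n + c))) ≤
    K * (∫⁻ y in Ioi (0:ℝ), ENNReal.ofReal (y ^ c) * G y) ^ ((n + 1 + c) / (n + c)) := by
  rcases hc.eq_or_lt with rfl | hc
  · refine ⟨1, by simp, fun G M hG hM h => ?_⟩
    have hn0 : n ≠ 0 := by linarith
    simp only [rpow_zero, ENNReal.ofReal_one, one_mul, add_zero, div_self hn0, ENNReal.rpow_one]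
    set A := ∫⁻ y in Ioi (0:ℝ), G y
    calc ∫⁻ y in Ioi (0:ℝ), M y ^ (1 / n) * G y ≤ ∫⁻ y in Ioi (0:ℝ), A ^ (1 / n) * G y := by
          apply setLIntegral_mono (by fun_prop)
          intro y hy
          gcongr
          exact (h y hy).trans (lintegral_mono_set (Ioi_subset_Ioi (le_of_lt hy)))
      _ = A ^ (1 / n) * A := by rw [lintegral_const_mul _ hG]
      _ = A ^ ((n + 1) / n) := by
          have : (n + 1) / n = 1 / n + 1 := by field_simp; ring
          rw [this, ENNReal.rpow_add_of_nonneg _ _ (by positivity) (by positivity), ENNReal.rpow_one]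
  · refine ⟨ENNReal.ofReal (1 / c) ^ (c / (n + c)), by finiteness, fun G M hG hM h => ?_⟩
    set A := ∫⁻ y in Ioi (0:ℝ), ENNReal.ofReal (y ^ c) * G y
    have hnc : 0 < n + c := by linarith
    have key : ∫⁻ y in Ioi (0:ℝ), ENNReal.ofReal (y ^ c) * M y ^ ((1 + c) / c) ≤
        A ^ (1 / c) * (ENNReal.ofReal (1 / c) * A) := by
      by_cases hA : A = ∞
      · simp [hA, hc]
      rw [← hardy_tail c hc G hG, ← lintegral_const_mul' _ _ (by finiteness)]
      apply setLIntegral_mono'  measurableSet_Ioi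
      intro y hy
      simp only [mem_Ioi] at hy
      calc ENNReal.ofReal (y ^ c) * M y ^ ((1 + c) / c)
          = (ENNReal.ofReal (y ^ c) * M y) ^ (1 / c) * (ENNReal.ofReal (y ^ (c - 1)) * M y) := by
            have e : (1 + c) / c = 1 / c + 1 := by field_simp
            rw [ENNReal.mul_rpow_of_nonneg _ _ (by positivity), e,
              ENNReal.rpow_add_of_nonneg _ _ (by positivity) (by positivity), ENNReal.rpow_one,
              ENNReal.ofReal_rpow_of_pos (by positivity), ← rpow_mul hy.le]
            have : y ^ c = y ^ (c * (1 / c)) * y ^ (c - 1) := by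
              rw [← rpow_add hy]; congr 1; field_simp; ring
            rw [this, ENNReal.ofReal_mul (by positivity)]
            ring
        _ ≤ _ := by
            gcongr
            · exact (mul_le_mul_right (h y hy) _).trans (w_mul_tail c hc.le G hG y hy)
            · exact h y hy
    calc _ = ∫⁻ y in Ioi (0:ℝ), (ENNReal.ofReal (y ^ c) * G y) ^ (n / (n + c)) *
            (ENNReal.ofReal (y ^ c) * M y ^ ((1 + c) / c)) ^ (c / (n + c)) := by
          apply lintegral_congr
          intro y
          have e : (1 + c) / c * (c / (n + c)) = (1 + c) / (n + c) := by field_simp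
          rw [ENNReal.mul_rpow_of_nonneg _ _ (by positivity),
            ENNReal.mul_rpow_of_nonneg _ _ (by positivity), ← ENNReal.rpow_mul, e]
          have : ENNReal.ofReal (y ^ c) = ENNReal.ofReal (y ^ c) ^ (n / (n + c)) *
              ENNReal.ofReal (y ^ c) ^ (c / (n + c)) := by
            rw [← ENNReal.rpow_add_of_nonneg _ _ (by positivity) (by positivity), ← add_div,
              div_self hnc.ne', ENNReal.rpow_one]
          conv_lhs => rw [this]
          ring
      _ ≤ A ^ (n / (n + c)) * (∫⁻ y in Ioi (0:ℝ), ENNReal.ofReal (y ^ c) * M y ^ ((1 + c) / c))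
            ^ (c / (n + c)) := by
          apply ENNReal.lintegral_mul_norm_pow_le (by fun_prop) (by fun_prop) (by positivity)
            (by positivity)
          field_simp
      _ ≤ A ^ (n / (n + c)) * (A ^ (1 / c) * (ENNReal.ofReal (1 / c) * A)) ^ (c / (n + c)) := by
          gcongr
      _ = _ := by
          have e : (n + 1 + c) / (n + c) = n / (n + c) + (1 / c * (c / (n + c)) + c / (n + c)) := by
            field_simp; ring
          rw [e, ENNReal.rpow_add_of_nonneg _ _ (by positivity) (by positivity),
            ENNReal.rpow_add_of_nonneg _ _ (by positivity) (by positivity), ENNReal.rpow_mul,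
            ENNReal.mul_rpow_of_nonneg _ _ (by positivity),
            ENNReal.mul_rpow_of_nonneg _ _ (by positivity)]
          ring

lemma slice (N : ℕ) (hN : 1 ≤ N) (c : ℝ) (hc : 0 ≤ c) (g : (Fin N → ℝ) → ℝ)
    (hg : ContDiff ℝ 1 g) (hs : HasCompactSupport g) :
    ∫⁻ x, ‖g x‖ₑ ^ (((N:ℝ) + 1 + c) / (N + c)) ≤
      (∫⁻ x, ‖g x‖ₑ) ^ ((1 + c) / ((N:ℝ) + c)) *
      (∫⁻ x, ‖fderiv ℝ g x‖ₑ) ^ ((N:ℝ) / (N + c)) := by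
  have hgc := hg.continuous
  rcases hN.eq_or_lt with rfl | hN
  · have hsup : ∀ x, ‖g x‖ₑ ≤ ∫⁻ x, ‖fderiv ℝ g x‖ₑ := by
      intro x
      let j : ℝ →L[ℝ] (Fin 1 → ℝ) := ContinuousLinearMap.pi (fun _ => ContinuousLinearMap.id ℝ ℝ)
      have hj : ∀ t, j t = (MeasurableEquiv.funUnique (Fin 1) ℝ).symm t := by
        intro t; ext i; rfl
      have hcl : Topology.IsClosedEmbedding j := by
        have : (j : ℝ → (Fin 1 → ℝ)) = (Homeomorph.funUnique (Fin 1) ℝ).symm := by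
          ext t i; rfl
        rw [this]
        exact (Homeomorph.funUnique (Fin 1) ℝ).symm.isClosedEmbedding
      have hx : x = j (x 0) := by ext i; fin_cases i; rfl
      have h1 := HasCompactSupport.enorm_le_lintegral_Ici_deriv (f := g ∘ j) (hg.comp j.contDiff)
        (hs.comp_isClosedEmbedding hcl) (x 0)
      calc ‖g x‖ₑ = ‖(g ∘ j) (x 0)‖ₑ := by rw [Function.comp, ← hx]
        _ ≤ ∫⁻ y in Iic (x 0), ‖deriv (g ∘ j) y‖ₑ := h1
        _ ≤ ∫⁻ y, ‖deriv (g ∘ j) y‖ₑ := setLIntegral_le_lintegral _ _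
        _ ≤ ∫⁻ y, ‖fderiv ℝ g (j y)‖ₑ := by
          gcongr with y
          have : HasDerivAt (g ∘ j) (fderiv ℝ g (j y) (j 1)) y :=
            HasFDerivAt.comp_hasDerivAt y
              (hg.differentiable one_ne_zero).differentiableAt.hasFDerivAt j.hasDerivAt
          rw [this.deriv]
          refine (ContinuousLinearMap.le_opENorm _ _).trans ?_
          have : ‖j 1‖ₑ = 1 := by
            have : ‖j 1‖ = 1 := by simp [j, Pi.norm_def]
            rw [← ofReal_norm, this]; simp
          rw [this, mul_one]
        _ = _ := by
          exact ((volume_preserving_funUnique (Fin 1) ℝ).symm _).lintegral_comp_emb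
            (MeasurableEquiv.measurableEmbedding _) (fun x => ‖fderiv ℝ g x‖ₑ)
    set S := ∫⁻ x, ‖fderiv ℝ g x‖ₑ
    calc ∫⁻ x, ‖g x‖ₑ ^ ((((1:ℕ):ℝ) + 1 + c) / ((1:ℕ) + c))
        ≤ ∫⁻ x, ‖g x‖ₑ * S ^ (((1:ℕ):ℝ) / ((1:ℕ) + c)) := by
          gcongr with x
          have e : (((1:ℕ):ℝ) + 1 + c) / ((1:ℕ) + c) = 1 + ((1:ℕ):ℝ) / ((1:ℕ) + c) := by
            push_cast; field_simp; ring
          rw [e, ENNReal.rpow_add_of_nonneg _ _ (by positivity) (by positivity), ENNReal.rpow_one]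
          gcongr
          exact hsup x
      _ = _ := by
          rw [lintegral_mul_const _ (by fun_prop)]
          congr 1
          have : (1 + c) / (((1:ℕ):ℝ) + c) = 1 := by push_cast; field_simp
          rw [this, ENNReal.rpow_one]
  · have hN1 : (1:ℝ) < N := by exact_mod_cast hN
    have hN2 : (0:ℝ) < N - 1 := by linarith
    have hp : Real.HolderConjugate (Fintype.card (Fin N)) ((N:ℝ) / (N - 1)) := by
      rw [Fintype.card_fin]
      exact Real.HolderConjugate.conjExponent hN1
    have h := lintegral_pow_le_pow_lintegral_fderiv_aux hp hg hs
    calc _ = ∫⁻ x, ‖g x‖ₑ ^ ((1 + c) / ((N:ℝ) + c)) *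
            (‖g x‖ₑ ^ ((N:ℝ) / (N - 1))) ^ (((N:ℝ) - 1) / (N + c)) := by
          congr! with x
          rw [← ENNReal.rpow_mul, ← ENNReal.rpow_add_of_nonneg _ _ (by positivity) (by positivity)]
          congr 1
          field_simp
          ring
      _ ≤ (∫⁻ x, ‖g x‖ₑ) ^ ((1 + c) / ((N:ℝ) + c)) *
          (∫⁻ x, ‖g x‖ₑ ^ ((N:ℝ) / (N - 1))) ^ (((N:ℝ) - 1) / (N + c)) := by
          apply ENNReal.lintegral_mul_norm_pow_le (by fun_prop) (by fun_prop) (by positivity)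
            (by positivity)
          field_simp
          ring
      _ ≤ (∫⁻ x, ‖g x‖ₑ) ^ ((1 + c) / ((N:ℝ) + c)) *
          ((∫⁻ x, ‖fderiv ℝ g x‖ₑ) ^ ((N:ℝ) / (N - 1))) ^ (((N:ℝ) - 1) / (N + c)) := by
          gcongr
      _ = _ := by
          rw [← ENNReal.rpow_mul]
          congr 2
          field_simp

/-- The weighted measure on the half-line. -/
noncomputable def nuc (c : ℝ) : Measure ℝ :=
  (volume.restrict (Ioi 0)).withDensity (fun y => ENNReal.ofReal (y ^ c))

/-- The weighted measure on the half-space. -/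
noncomputable def muc (N : ℕ) (c : ℝ) : Measure ((Fin N → ℝ) × ℝ) :=
  (volume : Measure (Fin N → ℝ)).prod (nuc c)

instance (c : ℝ) : SFinite (nuc c) := by unfold nuc; infer_instance

lemma nuc_lf (c : ℝ) (hc : 0 ≤ c) : IsLocallyFiniteMeasure (nuc c) := by
  unfold nuc
  exact IsLocallyFiniteMeasure.withDensity_ofReal (Real.continuous_rpow_const hc)

lemma lintegral_nuc (c : ℝ) (F : ℝ → ℝ≥0∞) (hF : Measurable F) :
    ∫⁻ y, F y ∂(nuc c) = ∫⁻ y in Ioi (0:ℝ), ENNReal.ofReal (y ^ c) * F y := by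
  unfold nuc
  rw [lintegral_withDensity_eq_lintegral_mul _ (by fun_prop) hF]
  rfl

lemma lintegral_muc (N : ℕ) (c : ℝ) (F : (Fin N → ℝ) × ℝ → ℝ≥0∞) (hF : Measurable F) :
    ∫⁻ z, F z ∂(muc N c) = ∫⁻ y in Ioi (0:ℝ), ENNReal.ofReal (y ^ c) * ∫⁻ x, F (x, y) := by
  unfold muc
  rw [lintegral_prod_symm' _ hF, lintegral_nuc]
  exact hF.lintegral_prod_left'

lemma lintegral_muc' (N : ℕ) (c : ℝ) (F : (Fin N → ℝ) × ℝ → ℝ≥0∞) (hF : Measurable F) :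
    ∫⁻ z, F z ∂(muc N c) = ∫⁻ z in {z : (Fin N → ℝ) × ℝ | 0 < z.2},
      F z * ENNReal.ofReal (z.2 ^ c) := by
  rw [lintegral_muc N c F hF]
  have : {z : (Fin N → ℝ) × ℝ | 0 < z.2} = univ ×ˢ Ioi (0:ℝ) := by ext z; simp
  rw [this, Measure.volume_eq_prod, setLIntegral_prod_symm _ (by fun_prop)]
  apply lintegral_congr
  intro y
  simp only [Measure.restrict_univ]
  rw [lintegral_mul_const _ (by fun_prop), mul_comm]

lemma sobolev_one (N : ℕ) (hN : 1 ≤ N) (c : ℝ) (hc : 0 ≤ c) : ∃ K : ℝ≥0∞, K ≠ ∞ ∧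
    ∀ v : (Fin N → ℝ) × ℝ → ℝ, ContDiff ℝ 1 v → HasCompactSupport v →
    ∫⁻ z, ‖v z‖ₑ ^ (((N:ℝ) + 1 + c) / (N + c)) ∂(muc N c) ≤
      K * (∫⁻ z, ‖fderiv ℝ v z‖ₑ ∂(muc N c)) ^ (((N:ℝ) + 1 + c) / (N + c)) := by
  obtain ⟨K, hK, h⟩ := oneD N c (by exact_mod_cast hN) hc
  refine ⟨K, hK, fun v hv hs => ?_⟩
  have hvc := hv.continuous
  have hfc : Continuous (fderiv ℝ v) := hv.continuous_fderiv one_ne_zero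
  have hm : Measurable (fun z => ‖fderiv ℝ v z‖ₑ) := hfc.enorm.measurable
  have hd := hv.differentiable one_ne_zero
  rw [lintegral_muc _ _ _ (by fun_prop), lintegral_muc _ _ _ hm]
  refine le_trans ?_ (h (fun y => ∫⁻ x, ‖fderiv ℝ v (x, y)‖ₑ) (fun y => ∫⁻ x, ‖v (x, y)‖ₑ)
    hm.lintegral_prod_left' ?_ ?_)
  · gcongr with y
    have hcl : Topology.IsClosedEmbedding (fun x : Fin N → ℝ => (x, y)) := by
      refine ⟨isEmbedding_prodMkLeft y, ?_⟩
      have : range (fun x : Fin N → ℝ => (x, y)) = Prod.snd ⁻¹' {y} := by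
        ext ⟨a, b⟩; simp [eq_comm]
      rw [this]
      exact isClosed_singleton.preimage continuous_snd
    refine (slice N hN c hc (fun x => v (x, y)) (by fun_prop)
      (hs.comp_isClosedEmbedding hcl)).trans ?_
    gcongr with x
    have : HasFDerivAt (fun x => v (x, y))
        ((fderiv ℝ v (x, y)).comp (ContinuousLinearMap.inl ℝ (Fin N → ℝ) ℝ)) x :=
      HasFDerivAt.comp x hd.differentiableAt.hasFDerivAt (hasFDerivAt_prodMk_left x y)
    rw [this.fderiv, ← ofReal_norm, ← ofReal_norm]
    gcongr
    refine (ContinuousLinearMap.opNorm_comp_le _ _).trans ?_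
    exact mul_le_of_le_one_right (norm_nonneg _) (ContinuousLinearMap.norm_inl_le_one ℝ _ _)
  · exact (hvc.enorm.measurable).lintegral_prod_left'
  · intro y hy
    rw [lintegral_lintegral_swap (by exact (hm.comp measurable_swap).aemeasurable)]
    gcongr with x
    have hcl : Topology.IsClosedEmbedding (fun t : ℝ => (x, -t)) := by
      have h1 : Topology.IsClosedEmbedding (fun t : ℝ => (x, t)) := by
        refine ⟨isEmbedding_prodMkRight x, ?_⟩
        have : range (fun t : ℝ => (x, t)) = Prod.fst ⁻¹' {x} := by
          ext ⟨a, b⟩; simp [eq_comm]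
        rw [this]
        exact isClosed_singleton.preimage continuous_fst
      exact h1.comp (Homeomorph.neg ℝ).isClosedEmbedding
    have h1 := HasCompactSupport.enorm_le_lintegral_Ici_deriv (f := fun t => v (x, -t))
      (by fun_prop) (hs.comp_isClosedEmbedding hcl) (-y)
    simp only [neg_neg] at h1
    refine h1.trans ?_
    have h2 : ∀ t, ‖deriv (fun t => v (x, -t)) t‖ₑ ≤ ‖fderiv ℝ v (x, -t)‖ₑ := by
      intro t
      have h3 : HasDerivAt (fun t : ℝ => (x, -t)) ((0 : Fin N → ℝ), (-1:ℝ)) t :=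
        (hasDerivAt_const t x).prodMk (hasDerivAt_neg t)
      have h4 : HasDerivAt (fun t => v (x, -t)) (fderiv ℝ v (x, -t) (0, -1)) t :=
        HasFDerivAt.comp_hasDerivAt t hd.differentiableAt.hasFDerivAt h3
      rw [h4.deriv]
      refine (ContinuousLinearMap.le_opENorm _ _).trans ?_
      have : ‖((0 : Fin N → ℝ), (-1:ℝ))‖ₑ = 1 := by
        rw [← ofReal_norm]; simp [Prod.norm_def]
      rw [this, mul_one]
    calc _ ≤ ∫⁻ t in Iic (-y), ‖fderiv ℝ v (x, -t)‖ₑ := by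
          gcongr with t; exact h2 t
      _ = ∫⁻ t in Ici y, ‖fderiv ℝ v (x, t)‖ₑ := by
          have := (Measure.measurePreserving_neg (volume : Measure ℝ)).setLIntegral_comp_preimage_emb
            (MeasurableEquiv.neg ℝ).measurableEmbedding (fun t => ‖fderiv ℝ v (x, t)‖ₑ) (Ici y)
          simpa using this
      _ = _ := by exact setLIntegral_congr Ioi_ae_eq_Ici.symm

lemma muc_fin (N : ℕ) (c : ℝ) (hc : 0 ≤ c) (f : (Fin N → ℝ) × ℝ → ℝ) (hf : Continuous f)
    (hs : HasCompactSupport f) (p : ℝ) (hp : 0 < p) : ∫⁻ z, ‖f z‖ₑ ^ p ∂(muc N c) ≠ ∞ := by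
  have := nuc_lf c hc
  have : IsLocallyFiniteMeasure (muc N c) := by unfold muc; infer_instance
  have h1 : Continuous (fun z => ‖f z‖ ^ p) := hf.norm.rpow_const (fun _ => Or.inr hp.le)
  have h2 : HasCompactSupport (fun z => ‖f z‖ ^ p) := hs.norm.rpow_const hp.ne'
  have h3 := (h1.integrable_of_hasCompactSupport (μ := muc N c) h2).2
  rw [HasFiniteIntegral] at h3
  simpa (discharger := positivity) [Real.enorm_rpow_of_nonneg] using h3.ne

lemma sobolev_two (N : ℕ) (hN : 1 ≤ N) (c : ℝ) (hc : 0 ≤ c) (hD : 2 < (N:ℝ) + 1 + c) :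
    ∃ S : ℝ≥0∞, S ≠ ∞ ∧
    ∀ u : (Fin N → ℝ) × ℝ → ℝ, ContDiff ℝ 1 u → HasCompactSupport u →
    (∫⁻ z, ‖u z‖ₑ ^ (2 * ((N:ℝ) + 1 + c) / (N + c - 1)) ∂(muc N c)) ^
        ((N + c - 1) / (2 * ((N:ℝ) + 1 + c))) ≤
      S * (∫⁻ z, ‖fderiv ℝ u z‖ₑ ^ (2:ℝ) ∂(muc N c)) ^ (1 / 2 : ℝ) := by
  obtain ⟨K, hK, h⟩ := sobolev_one N hN c hc
  have d1 : 0 < (N:ℝ) + c - 1 := by linarith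
  have d2 : 0 < (N:ℝ) + c := by linarith
  have d3 : 0 < (N:ℝ) + 1 + c := by linarith
  let γ : NNReal := ⟨2 * ((N:ℝ) + c) / (N + c - 1), by positivity⟩
  have hγ : (γ : ℝ) = 2 * ((N:ℝ) + c) / (N + c - 1) := rfl
  have hγ1 : 1 < (γ : ℝ) := by rw [hγ, one_lt_div d1]; linarith
  refine ⟨K ^ (((N:ℝ) + c) / (N + 1 + c)) * γ, by finiteness, fun u hu hs => ?_⟩
  have huc := hu.continuous
  have hfc : Continuous (fderiv ℝ u) := hu.continuous_fderiv one_ne_zero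
  have hm : Measurable (fun z => ‖fderiv ℝ u z‖ₑ) := hfc.enorm.measurable
  set r := 2 * ((N:ℝ) + 1 + c) / (N + c - 1) with hr
  set s := ((N:ℝ) + 1 + c) / (N + c) with hsd
  have hs0 : 0 < s := by positivity
  have hr0 : 0 < r := by positivity
  have hsinv : ((N:ℝ) + c) / (N + 1 + c) = 1 / s := by rw [hsd, one_div_div]
  have hrinv : (N + c - 1) / (2 * ((N:ℝ) + 1 + c)) = 1 / r := by rw [hr, one_div_div]
  have hrs : 1 / r = 1 / s - 1 / 2 := by rw [hr, hsd]; field_simp; ring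
  rw [hsinv, hrinv]
  set X := ∫⁻ z, ‖u z‖ₑ ^ r ∂(muc N c) with hX
  set B := ∫⁻ z, ‖fderiv ℝ u z‖ₑ ^ (2:ℝ) ∂(muc N c)
  have hXf : X ≠ ∞ := muc_fin N c hc u huc hs r hr0
  by_cases hX0 : X = 0
  · rw [hX0, ENNReal.zero_rpow_of_pos (by positivity)]; positivity
  let v : (Fin N → ℝ) × ℝ → ℝ := fun x ↦ ‖u x‖ ^ (γ : ℝ)
  have hv : ContDiff ℝ 1 v := hu.norm_rpow hγ1
  have h2v : HasCompactSupport v := hs.norm.rpow_const (by positivity)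
  have h1 := h v hv h2v
  have h2 : ∫⁻ z, ‖v z‖ₑ ^ s ∂(muc N c) = X := by
    apply lintegral_congr
    intro z
    have e : r = γ * s := by rw [hr, hγ, hsd]; field_simp
    rw [e, ENNReal.rpow_mul]
    simp (discharger := positivity) [v, Real.enorm_rpow_of_nonneg]
  have h3 : ∫⁻ z, ‖fderiv ℝ v z‖ₑ ∂(muc N c) ≤ γ * (X ^ (1/2:ℝ) * B ^ (1/2:ℝ)) := by
    calc _ ≤ ∫⁻ z, γ * ((‖u z‖ₑ ^ r) ^ (1/2:ℝ) * (‖fderiv ℝ u z‖ₑ ^ (2:ℝ)) ^ (1/2:ℝ))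
            ∂(muc N c) := by
          gcongr with z
          refine (enorm_fderiv_norm_rpow_le (hu.differentiable one_ne_zero) hγ1).trans ?_
          have e : r * (1/2) = γ - 1 := by rw [hr, hγ]; field_simp; ring
          rw [← ENNReal.rpow_mul, ← ENNReal.rpow_mul, e, mul_assoc]
          simp
      _ = γ * ∫⁻ z, ((‖u z‖ₑ ^ r) ^ (1/2:ℝ) * (‖fderiv ℝ u z‖ₑ ^ (2:ℝ)) ^ (1/2:ℝ))
            ∂(muc N c) := lintegral_const_mul' _ _ (by simp)
      _ ≤ _ := by
          gcongr
          exact ENNReal.lintegral_mul_norm_pow_le (by fun_prop) (by fun_prop) (by positivity)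
            (by positivity) (by norm_num)
  rw [h2] at h1
  have h4 : X ≤ K * (γ * (X ^ (1/2:ℝ) * B ^ (1/2:ℝ))) ^ s := h1.trans (by gcongr)
  have h5 : X ^ (1 / s) ≤ K ^ (1 / s) * γ * B ^ (1/2:ℝ) * X ^ (1/2:ℝ) := by
    calc X ^ (1 / s) ≤ (K * (γ * (X ^ (1/2:ℝ) * B ^ (1/2:ℝ))) ^ s) ^ (1 / s) := by gcongr
      _ = _ := by
        rw [ENNReal.mul_rpow_of_nonneg _ _ (by positivity), ← ENNReal.rpow_mul,
          mul_one_div_cancel hs0.ne', ENNReal.rpow_one]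
        ring
  rw [hrs, ENNReal.rpow_sub _ _ hX0 hXf, ENNReal.div_le_iff]
  · exact h5
  · exact (ENNReal.rpow_pos (pos_iff_ne_zero.mpr hX0) hXf).ne'
  · finiteness

lemma interp (N : ℕ) (hN : 1 ≤ N) (c : ℝ) (hc : 0 ≤ c) (hD : 2 < (N:ℝ) + 1 + c) :
    ∃ S : ℝ≥0∞, S ≠ ∞ ∧ ∀ q θ : ℝ, 2 < q → q ≤ 2 * ((N : ℝ) + 1 + c) / ((N : ℝ) + c - 1) →
      θ = ((N : ℝ) + 1 + c) * (1 / 2 - 1 / q) →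
    ∀ u : (Fin N → ℝ) × ℝ → ℝ, ContDiff ℝ 1 u → HasCompactSupport u →
    (∫⁻ z, ‖u z‖ₑ ^ q ∂(muc N c)) ^ (1 / q) ≤
      S * ((∫⁻ z, ‖fderiv ℝ u z‖ₑ ^ (2:ℝ) ∂(muc N c)) ^ (1 / 2 : ℝ)) ^ θ *
        ((∫⁻ z, ‖u z‖ₑ ^ (2:ℝ) ∂(muc N c)) ^ (1 / 2 : ℝ)) ^ (1 - θ) := by
  obtain ⟨S, hS, h⟩ := sobolev_two N hN c hc hD
  refine ⟨max S 1, by simp [hS], fun q θ hq hq' hθ u hu hs => ?_⟩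
  have huc := hu.continuous
  have h0 := h u hu hs
  have d1 : 0 < (N:ℝ) + c - 1 := by linarith
  have d3 : 0 < (N:ℝ) + 1 + c := by linarith
  set r := 2 * ((N:ℝ) + 1 + c) / (N + c - 1) with hr
  have hr2 : 2 < r := by rw [hr, lt_div_iff₀ d1]; linarith
  have hrinv : (N + c - 1) / (2 * ((N:ℝ) + 1 + c)) = 1 / r := by rw [hr, one_div_div]
  have hDr : (N:ℝ) + 1 + c = 2 * r / (r - 2) := by
    have : r - 2 = 4 / (N + c - 1) := by rw [hr]; field_simp; ring
    rw [this, hr]; field_simp; ring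
  rw [hrinv] at h0
  rw [hDr] at hθ
  clear_value r
  have hr3 : 0 < r - 2 := by linarith
  have hr4 : r - 2 ≠ 0 := hr3.ne'
  set X := ∫⁻ z, ‖u z‖ₑ ^ r ∂(muc N c)
  set B := ∫⁻ z, ‖fderiv ℝ u z‖ₑ ^ (2:ℝ) ∂(muc N c)
  set E := ∫⁻ z, ‖u z‖ₑ ^ (2:ℝ) ∂(muc N c)
  have ha : 0 ≤ (r - q) / (r - 2) := div_nonneg (by linarith) hr3.le
  have hb : 0 ≤ (q - 2) / (r - 2) := div_nonneg (by linarith) hr3.le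
  have hq0 : 0 < q := by linarith
  have hr0 : 0 < r := by linarith
  have hθ0 : (1 / r) * θ = (q - 2) / (r - 2) * (1 / q) := by rw [hθ]; field_simp
  have hθ1 : (1 / 2) * (1 - θ) = (r - q) / (r - 2) * (1 / q) := by rw [hθ]; field_simp; ring
  have hθp : 0 ≤ θ := by
    have : 0 ≤ (q - 2) / (r - 2) * (1 / q) := by positivity
    rw [← hθ0] at this
    exact nonneg_of_mul_nonneg_right this (by positivity)
  have hθl : θ ≤ 1 := by
    have : 0 ≤ (r - q) / (r - 2) * (1 / q) := by positivity
    rw [← hθ1] at this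
    linarith
  have h1 : ∫⁻ z, ‖u z‖ₑ ^ q ∂(muc N c) ≤ E ^ ((r - q) / (r - 2)) * X ^ ((q - 2) / (r - 2)) := by
    calc _ = ∫⁻ z, (‖u z‖ₑ ^ (2:ℝ)) ^ ((r - q) / (r - 2)) * (‖u z‖ₑ ^ r) ^ ((q - 2) / (r - 2))
            ∂(muc N c) := by
          apply lintegral_congr
          intro z
          rw [← ENNReal.rpow_mul, ← ENNReal.rpow_mul,
            ← ENNReal.rpow_add_of_nonneg _ _ (by positivity) (by positivity)]
          congr 1
          field_simp
          ring
      _ ≤ _ := ENNReal.lintegral_mul_norm_pow_le (by fun_prop) (by fun_prop) ha hb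
            (by field_simp; ring)
  calc _ ≤ (E ^ ((r - q) / (r - 2)) * X ^ ((q - 2) / (r - 2))) ^ (1 / q) := by gcongr
    _ = (X ^ (1 / r)) ^ θ * (E ^ (1/2:ℝ)) ^ (1 - θ) := by
        rw [ENNReal.mul_rpow_of_nonneg _ _ (by positivity), ← ENNReal.rpow_mul,
          ← ENNReal.rpow_mul, ← ENNReal.rpow_mul, ← ENNReal.rpow_mul, hθ0, hθ1, mul_comm]
    _ ≤ (S * B ^ (1/2:ℝ)) ^ θ * (E ^ (1/2:ℝ)) ^ (1 - θ) := by gcongr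
    _ = S ^ θ * (B ^ (1/2:ℝ)) ^ θ * (E ^ (1/2:ℝ)) ^ (1 - θ) := by
        rw [ENNReal.mul_rpow_of_nonneg _ _ hθp]
    _ ≤ _ := by
        gcongr
        calc S ^ θ ≤ (max S 1) ^ θ := by gcongr; exact le_max_left _ _
          _ ≤ (max S 1) ^ (1:ℝ) := ENNReal.rpow_le_rpow_of_exponent_le (le_max_right _ _) hθl
          _ = _ := by simp

lemma integral_HS (N : ℕ) (c : ℝ) (f : (Fin N → ℝ) × ℝ → ℝ) (p : ℝ) (hp : 0 ≤ p)
    (hf : Continuous f) :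
    ∫ z in HS N, |f z| ^ p * z.2 ^ c = (∫⁻ z, ‖f z‖ₑ ^ p ∂(muc N c)).toReal := by
  have hHS : MeasurableSet (HS N) := measurableSet_lt measurable_const measurable_snd
  rw [lintegral_muc' _ _ _ (by fun_prop), integral_eq_lintegral_of_nonneg_ae]
  · congr 1
    apply setLIntegral_congr_fun hHS
    intro z hz
    have hz' : 0 < z.2 := hz
    dsimp only
    rw [ENNReal.ofReal_mul (by positivity), ← ENNReal.ofReal_rpow_of_nonneg (abs_nonneg _) hp,
      Real.enorm_eq_ofReal_abs]
  · filter_upwards [ae_restrict_mem hHS] with z hz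
    have hz' : 0 < z.2 := hz
    positivity
  · apply Measurable.aestronglyMeasurable
    have := hf.measurable
    fun_prop

lemma gradNorm_nonneg {N : ℕ} (u : ((Fin N → ℝ) × ℝ) → ℝ) (z) : 0 ≤ gradNorm u z :=
  Real.sqrt_nonneg _

lemma norm_fderiv_le {N : ℕ} (u : ((Fin N → ℝ) × ℝ) → ℝ) (z : (Fin N → ℝ) × ℝ) :
    ‖fderiv ℝ u z‖ ≤ (N + 1) * gradNorm u z := by
  have g0 := gradNorm_nonneg u z
  have hx : ∀ i, |pX u i z| ≤ gradNorm u z := by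
    intro i
    apply Real.abs_le_sqrt
    have := Finset.single_le_sum (f := fun i => pX u i z ^ 2) (fun i _ => sq_nonneg _)
      (Finset.mem_univ i)
    have h2 := sq_nonneg (pY u z)
    linarith
  have hy : |pY u z| ≤ gradNorm u z := by
    apply Real.abs_le_sqrt
    have := Finset.sum_nonneg (f := fun i => pX u i z ^ 2) (s := Finset.univ)
      (fun i _ => sq_nonneg _)
    linarith
  apply ContinuousLinearMap.opNorm_le_bound _ (by positivity)
  rintro ⟨a, b⟩
  have e : ((a, b) : (Fin N → ℝ) × ℝ) =
      (∑ i, a i • ((Pi.single i 1, 0) : (Fin N → ℝ) × ℝ)) + b • ((0, 1) : (Fin N → ℝ) × ℝ) := by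
    ext j
    · simp [Prod.fst_sum, Finset.sum_apply, Pi.single_apply]
    · simp [Prod.snd_sum]
  have e2 : fderiv ℝ u z (a, b) = (∑ i, a i * pX u i z) + b * pY u z := by
    conv_lhs => rw [e]
    simp only [map_add, map_sum, map_smul, smul_eq_mul, pX, pY]
  have ha : ∀ i, |a i| ≤ ‖(a, b)‖ := fun i =>
    (norm_le_pi_norm a i).trans (norm_fst_le (a, b))
  have hb : |b| ≤ ‖(a, b)‖ := norm_snd_le (a, b)
  rw [e2, Real.norm_eq_abs]
  calc _ ≤ |∑ i, a i * pX u i z| + |b * pY u z| := abs_add_le _ _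
    _ ≤ (∑ i, |a i * pX u i z|) + |b * pY u z| := by
        gcongr; exact Finset.abs_sum_le_sum_abs _ _
    _ ≤ (∑ i : Fin N, ‖(a, b)‖ * gradNorm u z) + ‖(a, b)‖ * gradNorm u z := by
        simp only [abs_mul]
        gcongr with i
        · exact ha i
        · exact hx i
    _ = _ := by simp; ring

/-- Gagliardo–Nirenberg inequality: for `c ≥ 0` (`c > 0` when `N = 1`),
`2 < q ≤ 2*_c = 2(N+1+c)/(N+c−1)` and `θ = (N+1+c)(1/2 − 1/q)` one has
`‖u‖_{L^q_c} ≤ C ‖∇u‖_{L²_c}^θ ‖u‖_{L²_c}^{1−θ}` for all smooth compactly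
supported `u` on the closed half-space, with `C` depending only on `c` and `N`. -/
theorem stmt_5 (N : ℕ) (hN : 1 ≤ N) (c : ℝ) (hc : 0 ≤ c) (hc1 : N = 1 → 0 < c) :
    ∃ C > 0, ∀ q θ : ℝ, 2 < q → q ≤ 2 * ((N : ℝ) + 1 + c) / ((N : ℝ) + c - 1) →
      θ = ((N : ℝ) + 1 + c) * (1 / 2 - 1 / q) →
      ∀ u : ((Fin N → ℝ) × ℝ) → ℝ, ContDiff ℝ (⊤ : ℕ∞) u → HasCompactSupport u →
        (∫ z in HS N, |u z| ^ q * z.2 ^ c) ^ (1 / q) ≤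
          C * ((∫ z in HS N, gradNorm u z ^ 2 * z.2 ^ c) ^ (1 / 2 : ℝ)) ^ θ *
            ((∫ z in HS N, u z ^ 2 * z.2 ^ c) ^ (1 / 2 : ℝ)) ^ (1 - θ) := by
  have hD : 2 < (N:ℝ) + 1 + c := by
    rcases hN.eq_or_lt with h | h
    · have := hc1 h.symm
      rw [← h]; push_cast; linarith
    · have : (2:ℝ) ≤ N := by exact_mod_cast h
      linarith
  obtain ⟨S, hS, h⟩ := interp N hN c hc hD
  refine ⟨(S * ((N:ℝ≥0∞) + 1)).toReal + 1, by positivity, fun q θ hq hq' hθ u hu hs => ?_⟩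
  have hu1 : ContDiff ℝ 1 u := hu.of_le (by exact_mod_cast le_top)
  have huc := hu1.continuous
  have hfc : Continuous (fderiv ℝ u) := hu1.continuous_fderiv one_ne_zero
  have h0 := h q θ hq hq' hθ u hu1 hs
  have hq0 : 0 < q := by linarith
  have hgc : Continuous (gradNorm u) := by
    unfold gradNorm pX pY
    fun_prop
  have hgs : HasCompactSupport (gradNorm u) := by
    have h1 : HasCompactSupport (fderiv ℝ u) := hs.fderiv ℝ
    refine h1.mono ?_
    intro z hz hz'
    apply hz
    simp [gradNorm, pX, pY, hz']
  have d1 : 0 < (N:ℝ) + c - 1 := by linarith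
  have hqi : 1 / q ≤ 1 / 2 := one_div_le_one_div_of_le (by norm_num) hq.le
  have hθ0 : 0 ≤ θ := by rw [hθ]; apply mul_nonneg <;> linarith
  have hθ1 : θ ≤ 1 := by
    have h3 : (N + c - 1) / (2 * ((N:ℝ) + 1 + c)) ≤ 1 / q := by
      rw [← one_div_div]
      exact one_div_le_one_div_of_le hq0 hq'
    rw [hθ]
    calc ((N : ℝ) + 1 + c) * (1 / 2 - 1 / q)
        ≤ ((N : ℝ) + 1 + c) * (1 / 2 - (N + c - 1) / (2 * ((N:ℝ) + 1 + c))) := by gcongr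
      _ = 1 := by field_simp; ring
  have i1 := integral_HS N c u q hq0.le huc
  have i2 : ∫ z in HS N, u z ^ 2 * z.2 ^ c = (∫⁻ z, ‖u z‖ₑ ^ (2:ℝ) ∂(muc N c)).toReal := by
    rw [← integral_HS N c u 2 (by norm_num) huc]
    simp
  have i3 : ∫ z in HS N, gradNorm u z ^ 2 * z.2 ^ c =
      (∫⁻ z, ‖gradNorm u z‖ₑ ^ (2:ℝ) ∂(muc N c)).toReal := by
    rw [← integral_HS N c (gradNorm u) 2 (by norm_num) hgc]
    simp
  rw [i1, i2, i3]
  have hEf := muc_fin N c hc u huc hs 2 (by norm_num)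
  have hBf := muc_fin N c hc _ hgc hgs 2 (by norm_num)
  have hB : (∫⁻ z, ‖fderiv ℝ u z‖ₑ ^ (2:ℝ) ∂(muc N c)) ^ (1 / 2 : ℝ) ≤
      ((N:ℝ≥0∞) + 1) * (∫⁻ z, ‖gradNorm u z‖ₑ ^ (2:ℝ) ∂(muc N c)) ^ (1 / 2 : ℝ) := by
    calc _ ≤ (((N:ℝ≥0∞) + 1) ^ (2:ℝ) * ∫⁻ z, ‖gradNorm u z‖ₑ ^ (2:ℝ) ∂(muc N c)) ^ (1 / 2 : ℝ) := by
          rw [← lintegral_const_mul' _ _ (by finiteness)]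
          gcongr with z
          rw [← ENNReal.mul_rpow_of_nonneg _ _ (by norm_num)]
          gcongr
          rw [← ofReal_norm, Real.enorm_eq_ofReal (gradNorm_nonneg u z)]
          refine (ENNReal.ofReal_le_ofReal (norm_fderiv_le u z)).trans ?_
          rw [ENNReal.ofReal_mul (by positivity), ENNReal.ofReal_add (by positivity) (by positivity)]
          simp
      _ = _ := by
          rw [ENNReal.mul_rpow_of_nonneg _ _ (by norm_num), ← ENNReal.rpow_mul]
          simp
  set E := ∫⁻ z, ‖u z‖ₑ ^ (2:ℝ) ∂(muc N c)
  set B := ∫⁻ z, ‖gradNorm u z‖ₑ ^ (2:ℝ) ∂(muc N c)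
  have h1 : (∫⁻ z, ‖u z‖ₑ ^ q ∂(muc N c)) ^ (1 / q) ≤
      S * ((N:ℝ≥0∞) + 1) * (B ^ (1 / 2 : ℝ)) ^ θ * (E ^ (1 / 2 : ℝ)) ^ (1 - θ) := by
    refine h0.trans (mul_le_mul_left ?_ _)
    rw [mul_assoc]
    refine mul_le_mul_right ?_ _
    calc _ ≤ (((N:ℝ≥0∞) + 1) * B ^ (1 / 2 : ℝ)) ^ θ := by gcongr
      _ = ((N:ℝ≥0∞) + 1) ^ θ * (B ^ (1 / 2 : ℝ)) ^ θ := ENNReal.mul_rpow_of_nonneg _ _ hθ0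
      _ ≤ _ := by
        gcongr
        calc ((N:ℝ≥0∞) + 1) ^ θ ≤ ((N:ℝ≥0∞) + 1) ^ (1:ℝ) :=
              ENNReal.rpow_le_rpow_of_exponent_le (by simp) hθ1
          _ = _ := by simp
  have hθ2 : 0 ≤ 1 - θ := by linarith
  have h2 := ENNReal.toReal_mono (by finiteness) h1
  simp only [ENNReal.toReal_mul, ← ENNReal.toReal_rpow] at h2 ⊢
  refine h2.trans ?_
  gcongr
  simp
end
end
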